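/- Let a_1, a_2, a_3, a_4 ∈ ℤ. The map (p,q) ↦ (p² − a_1pq + a_2q², pq, q²) induces a bijection from the set {(p,q) ∈ ℤ² : Q_1(p² − a_1pq + a_2q², pq, q²) = 1} modulo the identification (p,q) ∼ (−p,−q), onto the set {(x,y,z) ∈ ℤ³ : Q_1(x,y,z) = 1 and Q_2(x,y,z) = 0} modulo the identification (x,y,z) ∼ (−x,−y,−z), where Q_1(X,Y,Z) = X² − a_1XY + a_2Y² + (a_1² − 2a_2)XZ + (a_3 − a_1a_2)YZ + (−a_1a_3 + a_2² + a_4)Z² and Q_2(X,Y,Z) = Y² − XZ − a_1YZ + a_2Z². -/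

import Mathlib

/-- The ternary quadratic form `Q₁`. -/
def Q1 (a1 a2 a3 a4 x y z : ℤ) : ℤ :=
  x ^ 2 - a1 * x * y + a2 * y ^ 2 + (a1 ^ 2 - 2 * a2) * x * z +
    (a3 - a1 * a2) * y * z + (-(a1 * a3) + a2 ^ 2 + a4) * z ^ 2

/-- The ternary quadratic form `Q₂`. -/
def Q2 (a1 a2 x y z : ℤ) : ℤ :=
  y ^ 2 - x * z - a1 * y * z + a2 * z ^ 2

/-- Solutions `(p,q)` of the quartic Thue equation `Q₁(p² − a₁pq + a₂q², pq, q²) = 1`. -/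
abbrev ThueSol (a1 a2 a3 a4 : ℤ) : Type :=
  {p : ℤ × ℤ //
    Q1 a1 a2 a3 a4 (p.1 ^ 2 - a1 * p.1 * p.2 + a2 * p.2 ^ 2) (p.1 * p.2) (p.2 ^ 2) = 1}

/-- Solutions `(x,y,z)` of the system `Q₁(x,y,z) = 1`, `Q₂(x,y,z) = 0`. -/
abbrev SysSol (a1 a2 a3 a4 : ℤ) : Type :=
  {t : ℤ × ℤ × ℤ //
    Q1 a1 a2 a3 a4 t.1 t.2.1 t.2.2 = 1 ∧ Q2 a1 a2 t.1 t.2.1 t.2.2 = 0}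

/-- Identification of `(p,q)` with `(−p,−q)`. -/
def pmRelPair (a1 a2 a3 a4 : ℤ) (p q : ThueSol a1 a2 a3 a4) : Prop :=
  (p : ℤ × ℤ) = (q : ℤ × ℤ) ∨ (p : ℤ × ℤ) = -(q : ℤ × ℤ)

/-- Identification of `(x,y,z)` with `(−x,−y,−z)`. -/
def pmRelTriple (a1 a2 a3 a4 : ℤ) (s t : SysSol a1 a2 a3 a4) : Prop :=
  (s : ℤ × ℤ × ℤ) = (t : ℤ × ℤ × ℤ) ∨ (s : ℤ × ℤ × ℤ) = -(t : ℤ × ℤ × ℤ)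

theorem Int.exists_sq_of_isCoprime_of_mul_eq_sq {w y z : ℤ} (h : IsCoprime z w)
    (e : z * w = y ^ 2) :
    ∃ p q : ℤ, (w = p ^ 2 ∧ y = p * q ∧ z = q ^ 2) ∨
      (w = -p ^ 2 ∧ y = -(p * q) ∧ z = -q ^ 2) := by
  obtain ⟨q, hq⟩ := Int.sq_of_isCoprime h e
  obtain ⟨p, hp⟩ := Int.sq_of_isCoprime h.symm (by rw [mul_comm, e])
  have mixed (hy : y ^ 2 = -(p * q) ^ 2) : y = 0 ∧ (p = 0 ∨ q = 0) := by
    have hy0 : y = 0 := by nlinarith [sq_nonneg (p * q), sq_nonneg y]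
    refine ⟨hy0, mul_eq_zero.mp ?_⟩
    simpa [hy0] using hy
  rcases hq with rfl | rfl <;> rcases hp with rfl | rfl
  · rcases sq_eq_sq_iff_eq_or_eq_neg.mp (show y ^ 2 = (p * q) ^ 2 by rw [← e]; ring)
      with hy | hy
    · exact ⟨p, q, .inl ⟨rfl, hy, rfl⟩⟩
    · exact ⟨-p, q, .inl ⟨by ring, by rw [hy]; ring, rfl⟩⟩
  · obtain ⟨rfl, rfl | rfl⟩ := mixed (by rw [← e]; ring)
    · exact ⟨0, q, .inl (by simp)⟩
    · exact ⟨p, 0, .inr (by simp)⟩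
  · obtain ⟨rfl, rfl | rfl⟩ := mixed (by rw [← e]; ring)
    · exact ⟨0, q, .inr (by simp)⟩
    · exact ⟨p, 0, .inl (by simp)⟩
  · rcases sq_eq_sq_iff_eq_or_eq_neg.mp (show y ^ 2 = (p * q) ^ 2 by rw [← e]; ring)
      with hy | hy
    · exact ⟨-p, q, .inr ⟨by ring, by rw [hy]; ring, rfl⟩⟩
    · exact ⟨p, q, .inr ⟨rfl, hy, rfl⟩⟩

theorem Q2_eq_zero_iff {a1 a2 x y z : ℤ} :
    Q2 a1 a2 x y z = 0 ↔ z * (x + a1 * y - a2 * z) = y ^ 2 := by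
  unfold Q2
  constructor <;> intro h <;> linear_combination -h

theorem Q2_param (a1 a2 p q : ℤ) :
    Q2 a1 a2 (p ^ 2 - a1 * p * q + a2 * q ^ 2) (p * q) (q ^ 2) = 0 := by
  unfold Q2
  ring

theorem Q1_neg (a1 a2 a3 a4 x y z : ℤ) :
    Q1 a1 a2 a3 a4 (-x) (-y) (-z) = Q1 a1 a2 a3 a4 x y z := by
  unfold Q1
  ring

theorem isCoprime_of_Q1_eq_one_of_Q2_eq_zero {a1 a2 a3 a4 x y z : ℤ}
    (h1 : Q1 a1 a2 a3 a4 x y z = 1) (h2 : Q2 a1 a2 x y z = 0) :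
    IsCoprime z (x + a1 * y - a2 * z) := by
  refine ⟨a2 ^ 2 * z - 3 * a1 * a2 * y + (a1 ^ 2 - 2 * a2) * (a2 * z - a1 * y) +
      (a3 - a1 * a2) * y + (-(a1 * a3) + a2 ^ 2 + a4) * z,
    (x + a1 * y - a2 * z) + 2 * (a2 * z - a1 * y) - a1 * y + (a1 ^ 2 - 2 * a2) * z +
      (2 * a1 ^ 2 + a2) * z, ?_⟩
  unfold Q1 at h1
  unfold Q2 at h2
  linear_combination h1 - (2 * a1 ^ 2 + a2) * h2

/-- Every solution of the system is, up to sign, in the image of the parametrization. -/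
theorem exists_param_of_Q1_eq_one_of_Q2_eq_zero {a1 a2 a3 a4 x y z : ℤ}
    (h1 : Q1 a1 a2 a3 a4 x y z = 1) (h2 : Q2 a1 a2 x y z = 0) :
    ∃ p q : ℤ,
      (p ^ 2 - a1 * p * q + a2 * q ^ 2 = x ∧ p * q = y ∧ q ^ 2 = z) ∨
      (p ^ 2 - a1 * p * q + a2 * q ^ 2 = -x ∧ p * q = -y ∧ q ^ 2 = -z) := by
  obtain ⟨p, q, ⟨hw, hy, hz⟩ | ⟨hw, hy, hz⟩⟩ := Int.exists_sq_of_isCoprime_of_mul_eq_sq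
    (isCoprime_of_Q1_eq_one_of_Q2_eq_zero h1 h2) (Q2_eq_zero_iff.mp h2)
  · exact ⟨p, q, .inl ⟨by linear_combination -hw + a1 * hy - a2 * hz, hy.symm, hz.symm⟩⟩
  · exact ⟨p, q, .inr ⟨by linear_combination hw - a1 * hy + a2 * hz,
      by rw [hy, neg_neg], by rw [hz, neg_neg]⟩⟩

theorem eq_or_eq_neg_of_sq_eq_of_mul_eq {p q r s : ℤ} (hp : p ^ 2 = r ^ 2)
    (hpq : p * q = r * s) (hq : q ^ 2 = s ^ 2) :
    (p = r ∧ q = s) ∨ (p = -r ∧ q = -s) := by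
  rcases sq_eq_sq_iff_eq_or_eq_neg.mp hp with rfl | rfl
  · rcases eq_or_ne p 0 with rfl | h0
    · simpa using sq_eq_sq_iff_eq_or_eq_neg.mp hq
    · exact .inl ⟨rfl, mul_left_cancel₀ h0 hpq⟩
  · rcases eq_or_ne r 0 with rfl | h0
    · simpa using sq_eq_sq_iff_eq_or_eq_neg.mp hq
    · exact .inr ⟨rfl, mul_left_cancel₀ h0 (by linear_combination -hpq)⟩

theorem eq_or_eq_neg_of_param_eq {a1 a2 p q r s : ℤ}
    (hx : p ^ 2 - a1 * p * q + a2 * q ^ 2 = r ^ 2 - a1 * r * s + a2 * s ^ 2)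
    (hy : p * q = r * s) (hz : q ^ 2 = s ^ 2) :
    (p = r ∧ q = s) ∨ (p = -r ∧ q = -s) :=
  eq_or_eq_neg_of_sq_eq_of_mul_eq (by linear_combination hx + a1 * hy - a2 * hz) hy hz

theorem eq_of_param_eq_neg {a1 a2 p q r s : ℤ}
    (hx : p ^ 2 - a1 * p * q + a2 * q ^ 2 = -(r ^ 2 - a1 * r * s + a2 * s ^ 2))
    (hy : p * q = -(r * s)) (hz : q ^ 2 = -s ^ 2) :
    p = r ∧ q = s := by
  have hw : p ^ 2 = -r ^ 2 := by linear_combination hx + a1 * hy - a2 * hz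
  have eq_of_sq_eq_neg {u v : ℤ} (h : u ^ 2 = -v ^ 2) : u = v := by
    have hu : u = 0 := by nlinarith [sq_nonneg u, sq_nonneg v]
    have hv : v = 0 := by nlinarith [sq_nonneg u, sq_nonneg v]
    rw [hu, hv]
  exact ⟨eq_of_sq_eq_neg hw, eq_of_sq_eq_neg hz⟩

theorem pmRelTriple_equivalence (a1 a2 a3 a4 : ℤ) : Equivalence (pmRelTriple a1 a2 a3 a4) where
  refl _ := .inl rfl
  symm := by
    rintro _ _ (h | h)
    · exact .inl h.symm
    · exact .inr (by rw [h, neg_neg])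
  trans := by
    rintro _ _ _ (h | h) (k | k)
    · exact .inl (h.trans k)
    · exact .inr (h.trans k)
    · exact .inr (by rw [h, k])
    · exact .inl (by rw [h, k, neg_neg])

/-- The map `(p,q) ↦ (p² − a₁pq + a₂q², pq, q²)` on solutions. -/
def ThueSol.toSysSol {a1 a2 a3 a4 : ℤ} (p : ThueSol a1 a2 a3 a4) : SysSol a1 a2 a3 a4 :=
  ⟨(p.1.1 ^ 2 - a1 * p.1.1 * p.1.2 + a2 * p.1.2 ^ 2, p.1.1 * p.1.2, p.1.2 ^ 2),
    p.2, Q2_param a1 a2 p.1.1 p.1.2⟩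

theorem ThueSol.toSysSol_eq_of_rel {a1 a2 a3 a4 : ℤ} {p q : ThueSol a1 a2 a3 a4}
    (h : pmRelPair a1 a2 a3 a4 p q) : p.toSysSol = q.toSysSol := by
  rcases h with h | h
  · rw [Subtype.ext h]
  · simp [toSysSol, h]

theorem ThueSol.rel_of_toSysSol_rel {a1 a2 a3 a4 : ℤ} {p q : ThueSol a1 a2 a3 a4}
    (h : pmRelTriple a1 a2 a3 a4 p.toSysSol q.toSysSol) : pmRelPair a1 a2 a3 a4 p q := by
  obtain ⟨⟨r, s⟩, _⟩ := q
  obtain ⟨⟨p, q⟩, _⟩ := p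
  simp only [pmRelTriple, pmRelPair, toSysSol, Prod.neg_mk, Prod.mk.injEq] at h ⊢
  rcases h with ⟨hx, hy, hz⟩ | ⟨hx, hy, hz⟩
  · exact eq_or_eq_neg_of_param_eq hx hy hz
  · exact .inl (eq_of_param_eq_neg hx hy hz)

theorem ThueSol.exists_toSysSol_rel {a1 a2 a3 a4 : ℤ} (t : SysSol a1 a2 a3 a4) :
    ∃ p : ThueSol a1 a2 a3 a4, pmRelTriple a1 a2 a3 a4 p.toSysSol t := by
  obtain ⟨⟨x, y, z⟩, h1, h2⟩ := t
  obtain ⟨p, q, ⟨hx, hy, hz⟩ | ⟨hx, hy, hz⟩⟩ := exists_param_of_Q1_eq_one_of_Q2_eq_zero h1 h2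
  · exact ⟨⟨(p, q), by rwa [hx, hy, hz]⟩,
      .inl (Prod.ext hx (Prod.ext hy hz))⟩
  · exact ⟨⟨(p, q), by rwa [hx, hy, hz, Q1_neg]⟩,
      .inr (Prod.ext hx (Prod.ext hy hz))⟩

/-- The map `(p,q) ↦ (p² − a₁pq + a₂q², pq, q²)` induces a bijection from the solutions
of the quartic Thue equation `Q₁(p² − a₁pq + a₂q², pq, q²) = 1` modulo `(p,q) ∼ (−p,−q)`
onto the solutions of the system `Q₁(x,y,z) = 1`, `Q₂(x,y,z) = 0` modulo
`(x,y,z) ∼ (−x,−y,−z)`. -/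
theorem thue_sols_biject_system_sols (a1 a2 a3 a4 : ℤ) :
    ∃ f : Quot (pmRelPair a1 a2 a3 a4) → Quot (pmRelTriple a1 a2 a3 a4),
      Function.Bijective f ∧
      ∀ (p : ThueSol a1 a2 a3 a4)
        (h : Q1 a1 a2 a3 a4 ((p : ℤ × ℤ).1 ^ 2 - a1 * (p : ℤ × ℤ).1 * (p : ℤ × ℤ).2 +
                a2 * (p : ℤ × ℤ).2 ^ 2) ((p : ℤ × ℤ).1 * (p : ℤ × ℤ).2)
                ((p : ℤ × ℤ).2 ^ 2) = 1 ∧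
              Q2 a1 a2 ((p : ℤ × ℤ).1 ^ 2 - a1 * (p : ℤ × ℤ).1 * (p : ℤ × ℤ).2 +
                a2 * (p : ℤ × ℤ).2 ^ 2) ((p : ℤ × ℤ).1 * (p : ℤ × ℤ).2)
                ((p : ℤ × ℤ).2 ^ 2) = 0),
        f (Quot.mk _ p) =
          Quot.mk _ ⟨((p : ℤ × ℤ).1 ^ 2 - a1 * (p : ℤ × ℤ).1 * (p : ℤ × ℤ).2 +
            a2 * (p : ℤ × ℤ).2 ^ 2, (p : ℤ × ℤ).1 * (p : ℤ × ℤ).2,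
            (p : ℤ × ℤ).2 ^ 2), h⟩ := by
  refine ⟨Quot.map ThueSol.toSysSol fun _ _ h => .inl (congrArg _ (ThueSol.toSysSol_eq_of_rel h)),
    ⟨?_, ?_⟩, fun _ _ => rfl⟩
  · rintro ⟨p⟩ ⟨q⟩ h
    exact Quot.sound (ThueSol.rel_of_toSysSol_rel
      ((pmRelTriple_equivalence a1 a2 a3 a4).eqvGen_iff.mp (Quot.eqvGen_exact h)))
  · rintro ⟨t⟩
    obtain ⟨p, hp⟩ := ThueSol.exists_toSysSol_rel t
    exact ⟨Quot.mk _ p, Quot.sound hp⟩
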